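/- Let κ₁ : 𝔹^m → 𝔹 be non-constant and define κ : 𝔹^{2m+1} → 𝔹 by κ(y, z, x_n) = κ₁(z) if x_n = 1 and κ₁(y) if x_n = 0 (where y, z ∈ 𝔹^m and n = 2m+1). For a point v = (u, u, 1) with κ₁(u) = 1, the Shapley value Sv(n) of feature n equals 0. -/

import Mathlib

open Finset

/-- `X` is a weak abductive explanation (weak AXp) for classifier `κ` at point `v`:
every point agreeing with `v` on `X` gets the same prediction as `v`. -/
def weakAXp {n : ℕ} (κ : (Fin n → Bool) → Bool) (v : Fin n → Bool)
    (X : Finset (Fin n)) : Prop :=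
  ∀ x : Fin n → Bool, (∀ i ∈ X, x i = v i) → κ x = κ v

/-- `X` is an AXp: a subset-minimal weak AXp. -/
def AXp {n : ℕ} (κ : (Fin n → Bool) → Bool) (v : Fin n → Bool)
    (X : Finset (Fin n)) : Prop :=
  weakAXp κ v X ∧ ∀ X' ⊂ X, ¬ weakAXp κ v X'

/-- `Y` is a weak contrastive explanation (weak CXp) for `κ` at `v`:
some point agreeing with `v` outside `Y` gets a different prediction. -/
def weakCXp {n : ℕ} (κ : (Fin n → Bool) → Bool) (v : Fin n → Bool)
    (Y : Finset (Fin n)) : Prop :=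
  ∃ x : Fin n → Bool, (∀ i ∉ Y, x i = v i) ∧ κ x ≠ κ v

/-- `Y` is a CXp: a subset-minimal weak CXp. -/
def CXp {n : ℕ} (κ : (Fin n → Bool) → Bool) (v : Fin n → Bool)
    (Y : Finset (Fin n)) : Prop :=
  weakCXp κ v Y ∧ ∀ Y' ⊂ Y, ¬ weakCXp κ v Y'

/-- A feature is relevant if it occurs in some AXp. -/
def Relevant {n : ℕ} (κ : (Fin n → Bool) → Bool) (v : Fin n → Bool) (i : Fin n) : Prop :=
  ∃ X, AXp κ v X ∧ i ∈ X

/-- A feature is irrelevant if it occurs in no AXp. -/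
def Irrelevant {n : ℕ} (κ : (Fin n → Bool) → Bool) (v : Fin n → Bool) (i : Fin n) : Prop :=
  ¬ Relevant κ v i

/-- `phi κ v S` : average value of `κ` over points agreeing with `v` on `S`
(uniform distribution). -/
noncomputable def phi {n : ℕ} (κ : (Fin n → Bool) → Bool) (v : Fin n → Bool)
    (S : Finset (Fin n)) : ℝ :=
  (1 / 2 ^ (n - S.card)) *
    ∑ x ∈ Finset.univ.filter (fun x : Fin n → Bool => ∀ i ∈ S, x i = v i),
      (if κ x then (1 : ℝ) else 0)

/-- Shapley value of feature `i` for classifier `κ` at point `v`. -/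
noncomputable def Sv {n : ℕ} (κ : (Fin n → Bool) → Bool) (v : Fin n → Bool)
    (i : Fin n) : ℝ :=
  ∑ S ∈ (Finset.univ.erase i).powerset,
    ((S.card.factorial * (n - S.card - 1).factorial : ℝ) / n.factorial) *
      (phi κ v (insert i S) - phi κ v S)

/-- Swap of the two blocks. -/
def swp (m : ℕ) (j : Fin (2 * m + 1)) : Fin (2 * m + 1) :=
  if h : (j : ℕ) < m then ⟨j + m, by omega⟩
  else if h2 : (j : ℕ) < m + m then ⟨j - m, by omega⟩ else j

theorem swp_val (m : ℕ) (j : Fin (2 * m + 1)) : (swp m j : ℕ) =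
    if (j : ℕ) < m then (j : ℕ) + m else if (j : ℕ) < m + m then (j : ℕ) - m else j := by
  unfold swp
  split_ifs <;> rfl

theorem swp_swp (m : ℕ) (j : Fin (2 * m + 1)) : swp m (swp m j) = j := by
  apply Fin.ext
  simp only [swp_val, Fin.val_last]
  split_ifs <;> omega

theorem swp_last (m : ℕ) : swp m (Fin.last (2 * m)) = Fin.last (2 * m) := by
  apply Fin.ext
  simp only [swp_val, Fin.val_last]
  split_ifs <;> omega

/-- Swap the blocks of a point and negate the last coordinate. -/
def tau (m : ℕ) (x : Fin (2 * m + 1) → Bool) : Fin (2 * m + 1) → Bool :=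
  fun j => if j = Fin.last (2 * m) then !(x j) else x (swp m j)

theorem swp_eq_last (m : ℕ) (j : Fin (2 * m + 1)) :
    swp m j = Fin.last (2 * m) ↔ j = Fin.last (2 * m) := by
  constructor
  · intro h
    rw [← swp_swp m j, h, swp_last]
  · rintro rfl
    exact swp_last m

theorem tau_tau (m : ℕ) (x : Fin (2 * m + 1) → Bool) : tau m (tau m x) = x := by
  funext j
  unfold tau
  by_cases h : j = Fin.last (2 * m)
  · simp [h]
  · simp [h, swp_eq_last, swp_swp]

/-- Signed sum. -/
noncomputable def dsum {m : ℕ} (κ : (Fin (2 * m + 1) → Bool) → Bool)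
    (v : Fin (2 * m + 1) → Bool) (S : Finset (Fin (2 * m + 1))) : ℝ :=
  ∑ x ∈ Finset.univ.filter (fun x : Fin (2 * m + 1) → Bool => ∀ i ∈ S, x i = v i),
    (if x (Fin.last (2 * m)) then (1 : ℝ) else -1) * (if κ x then (1 : ℝ) else 0)

theorem phi_diff {m : ℕ} (κ : (Fin (2 * m + 1) → Bool) → Bool)
    (v : Fin (2 * m + 1) → Bool) (hvL : v (Fin.last (2 * m)) = true)
    (S : Finset (Fin (2 * m + 1))) (hS : Fin.last (2 * m) ∉ S) :
    phi κ v (insert (Fin.last (2 * m)) S) - phi κ v S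
      = (1 / 2 ^ (2 * m + 1 - S.card)) * dsum κ v S := by
  have hc : S.card + 1 ≤ 2 * m + 1 := by
    rw [← Finset.card_insert_of_notMem hS]
    simpa using Finset.card_le_univ (insert (Fin.last (2 * m)) S)
  obtain ⟨k, hk⟩ := Nat.exists_eq_add_of_le hc
  have e1 : 2 * m + 1 - S.card = k + 1 := by omega
  have e2 : 2 * m + 1 - (S.card + 1) = k := by omega
  have hf : (Finset.univ.filter (fun x : Fin (2 * m + 1) → Bool =>
      ∀ i ∈ insert (Fin.last (2 * m)) S, x i = v i))
      = (Finset.univ.filter (fun x : Fin (2 * m + 1) → Bool => ∀ i ∈ S, x i = v i)).filter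
        (fun x => x (Fin.last (2 * m)) = true) := by
    ext x
    simp [hvL, and_comm]
  unfold phi dsum
  rw [Finset.card_insert_of_notMem hS, e1, e2, hf, Finset.sum_filter]
  have : (1 : ℝ) / 2 ^ k = (1 / 2 ^ (k + 1)) * 2 := by
    rw [pow_succ]; field_simp
  rw [this, mul_assoc, ← mul_sub, Finset.mul_sum, ← Finset.sum_sub_distrib]
  congr 1
  apply Finset.sum_congr rfl
  intro x _
  split_ifs <;> norm_num

theorem dsum_swp {m : ℕ} (κ : (Fin (2 * m + 1) → Bool) → Bool)
    (v : Fin (2 * m + 1) → Bool) (hκ : ∀ x, κ (tau m x) = κ x)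
    (hv : ∀ j, v (swp m j) = v j)
    (S : Finset (Fin (2 * m + 1))) (hS : Fin.last (2 * m) ∉ S) :
    dsum κ v (S.image (swp m)) = - dsum κ v S := by
  unfold dsum
  rw [← Finset.sum_neg_distrib]
  refine Finset.sum_nbij' (tau m) (tau m) ?_ ?_ ?_ ?_ ?_
  · intro x hx
    simp only [Finset.mem_filter, Finset.mem_univ, true_and, Finset.forall_mem_image] at hx ⊢
    intro i hi
    have : i ≠ Fin.last (2 * m) := fun h => hS (h ▸ hi)
    simp only [tau, this, if_false]
    rw [hx hi, hv]
  · intro x hx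
    simp only [Finset.mem_filter, Finset.mem_univ, true_and, Finset.forall_mem_image] at hx ⊢
    intro i hi
    have : i ≠ Fin.last (2 * m) := fun h => hS (h ▸ hi)
    simp only [tau, swp_eq_last, this, if_false, swp_swp]
    rw [hx i hi, hv]
  · intro x _
    exact tau_tau m x
  · intro x _
    exact tau_tau m x
  · intro x _
    rw [hκ]
    have : tau m x (Fin.last (2 * m)) = !(x (Fin.last (2 * m))) := by simp [tau]
    rw [this]
    cases x (Fin.last (2 * m)) <;> cases κ x <;> simp

/-- In the two-block construction `κ(y,z,xₙ) = if xₙ then κ₁ z else κ₁ y` on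
`n = 2m+1` features, with `v = (u,u,1)` and `κ₁ u = true`, the Shapley value of
feature `n` is zero. -/
theorem stmt11 (m : ℕ) (κ₁ : (Fin m → Bool) → Bool)
    (h1 : ∃ a b, κ₁ a ≠ κ₁ b) (u : Fin m → Bool) (hu : κ₁ u = true)
    (κ : (Fin (2 * m + 1) → Bool) → Bool)
    (hκ : ∀ x, κ x =
      if x (Fin.last (2 * m)) then
        κ₁ (fun i => x (Fin.castLE (by omega) (Fin.natAdd m i)))
      else κ₁ (fun i => x (Fin.castLE (by omega : m ≤ 2 * m + 1) i)))
    (v : Fin (2 * m + 1) → Bool)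
    (hv : ∀ j : Fin (2 * m + 1), v j =
      if h : (j : ℕ) < m then u ⟨j, h⟩
      else if h2 : (j : ℕ) < m + m then u ⟨(j : ℕ) - m, by omega⟩
      else true) :
    Sv κ v (Fin.last (2 * m)) = 0 := by
  have hvL : v (Fin.last (2 * m)) = true := by
    rw [hv]
    split_ifs with h h2
    · simp at h; omega
    · simp at h2; omega
    · rfl
  have hvs : ∀ j, v (swp m j) = v j := by
    intro j
    have hs := swp_val m j
    by_cases h : (j : ℕ) < m
    · rw [if_pos h] at hs
      rw [hv, dif_neg (by omega), dif_pos (by omega), hv j, dif_pos h]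
      congr 1
      apply Fin.ext
      simp only [hs]
      omega
    · rw [if_neg h] at hs
      by_cases h2 : (j : ℕ) < m + m
      · rw [if_pos h2] at hs
        rw [hv, dif_pos (by omega), hv j, dif_neg h, dif_pos h2]
        congr 1
        apply Fin.ext
        exact hs
      · rw [if_neg h2] at hs
        rw [Fin.ext hs]
  have hκt : ∀ x, κ (tau m x) = κ x := by
    intro x
    have hL : tau m x (Fin.last (2 * m)) = !(x (Fin.last (2 * m))) := by simp [tau]
    rw [hκ, hκ x, hL]
    have ha : ∀ i : Fin m, tau m x (Fin.castLE (by omega) (Fin.natAdd m i))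
        = x (Fin.castLE (by omega : m ≤ 2 * m + 1) i) := by
      intro i
      have hi := i.2
      unfold tau
      rw [if_neg (by intro h; have := congrArg Fin.val h; simp at this; omega)]
      congr 1
      apply Fin.ext
      simp only [swp_val, Fin.val_castLE, Fin.val_natAdd]
      split_ifs <;> omega
    have hb : ∀ i : Fin m, tau m x (Fin.castLE (by omega : m ≤ 2 * m + 1) i)
        = x (Fin.castLE (by omega) (Fin.natAdd m i)) := by
      intro i
      have hi := i.2
      unfold tau
      rw [if_neg (by intro h; have := congrArg Fin.val h; simp at this; omega)]
      congr 1
      apply Fin.ext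
      simp only [swp_val, Fin.val_castLE, Fin.val_natAdd]
      split_ifs <;> omega
    simp only [ha, hb]
    cases x (Fin.last (2 * m)) <;> simp
  have hinj : Function.Injective (swp m) := Function.Involutive.injective (swp_swp m)
  have hmem : ∀ S : Finset (Fin (2 * m + 1)),
      S ∈ (Finset.univ.erase (Fin.last (2 * m))).powerset ↔ Fin.last (2 * m) ∉ S := by
    intro S
    rw [Finset.mem_powerset, Finset.subset_erase]
    simp
  have himg : ∀ S : Finset (Fin (2 * m + 1)), Fin.last (2 * m) ∉ S →
      Fin.last (2 * m) ∉ S.image (swp m) := by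
    intro S hS h
    obtain ⟨a, ha, h⟩ := Finset.mem_image.1 h
    rw [swp_eq_last] at h
    exact hS (h ▸ ha)
  have hii : ∀ S : Finset (Fin (2 * m + 1)), (S.image (swp m)).image (swp m) = S := by
    intro S
    rw [Finset.image_image]
    have : swp m ∘ swp m = id := funext (swp_swp m)
    rw [this, Finset.image_id]
  have key : Sv κ v (Fin.last (2 * m)) = - Sv κ v (Fin.last (2 * m)) := by
    unfold Sv
    rw [← Finset.sum_neg_distrib]
    refine Finset.sum_nbij' (fun S => S.image (swp m)) (fun S => S.image (swp m)) ?_ ?_ ?_ ?_ ?_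
    · intro S hS
      rw [hmem] at hS ⊢
      exact himg S hS
    · intro S hS
      rw [hmem] at hS ⊢
      exact himg S hS
    · intro S _
      exact hii S
    · intro S _
      exact hii S
    · intro S hS
      rw [hmem] at hS
      rw [phi_diff κ v hvL S hS, phi_diff κ v hvL _ (himg S hS),
        Finset.card_image_of_injective S hinj, dsum_swp κ v hκt hvs S hS]
      ring
  linarith
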